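/- arXiv:2602.17506 — 2 statements merged into one kernel-verified Lean document; each statement's English description precedes it below -/
import Mathlib

section
/- A point p = (0, v0, u0, w0) on the triple collision manifold {s = 0} satisfying E(p) = 0 is an equilibrium point of the regularized blown-up system (i.e. the right-hand side vector field vanishes at p) if and only if w0 = 0, cos(u0) is nonzero, v0^2 = 2*W(u0)/cos(u0)^2, and the derivative of the function u |-> W(u)/cos(u)^2 vanishes at u0 (i.e. u0 is a critical point of the unregularized shape potential). -/
open Real Filter Topology MeasureTheory

/-- The regularized shape potential `W(u)` of the isosceles three-body problem with
masses `m1 = m2 = 1`, `m3`, where `mu = 2*m3/(2+m3)`. -/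
noncomputable def Wpot (m3 u : ℝ) : ℝ :=
  1 / Real.sqrt 2 +
    2 * m3 * Real.cos u ^ 2 /
      Real.sqrt (Real.cos u ^ 4 / 2 + (1 - Real.cos u ^ 4) / (2 * m3 / (2 + m3)))

/-- The energy function `E(s,v,u,w)` for energy `h`. -/
noncomputable def energyFn (m3 h s v u w : ℝ) : ℝ :=
  1 / 2 * (v ^ 2 * Real.cos u ^ 2 + w ^ 2) - (1 - s) * Wpot m3 u - h * s * Real.cos u ^ 2

/-- `(s,v,u,w) : ℝ → ℝ` is a (globally defined) solution of the regularized blown-up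
system of the isosceles three-body problem with mass `m3` and energy `h`. -/
def IsSolution (m3 h : ℝ) (s v u w : ℝ → ℝ) : Prop :=
  (∀ τ : ℝ, HasDerivAt s (v τ * s τ * (1 - s τ) * Real.cos (u τ) ^ 2) τ) ∧
  (∀ τ : ℝ, HasDerivAt v (1 / 2 * (1 - s τ) * v τ ^ 2 * Real.cos (u τ) ^ 2 + w τ ^ 2
      - (1 - s τ) * Wpot m3 (u τ)) τ) ∧
  (∀ τ : ℝ, HasDerivAt u (1 / 2 * Real.sqrt (1 + Real.cos (u τ) ^ 2) * w τ) τ) ∧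
  (∀ τ : ℝ, HasDerivAt w (-(1 / 2) * (1 + s τ) * v τ * w τ * Real.cos (u τ) ^ 2
      + 1 / 2 * Real.sqrt (1 + Real.cos (u τ) ^ 2) * (1 - s τ) * deriv (Wpot m3) (u τ)
      + 1 / 2 * (v τ ^ 2 - 2 * h * s τ) * Real.sqrt (1 + Real.cos (u τ) ^ 2)
          * Real.sin (u τ) * Real.cos (u τ)) τ)

/-- The solution satisfies the energy relation `E = 0` at all times. -/
def SatisfiesEnergy (m3 h : ℝ) (s v u w : ℝ → ℝ) : Prop :=
  ∀ τ : ℝ, energyFn m3 h (s τ) (v τ) (u τ) (w τ) = 0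

theorem Wpot_radicand_pos {m3 : ℝ} (hm3 : 0 < m3) (u : ℝ) :
    0 < Real.cos u ^ 4 / 2 + (1 - Real.cos u ^ 4) / (2 * m3 / (2 + m3)) := by
  have hmu : 0 < 2 * m3 / (2 + m3) := by positivity
  have hc : Real.cos u ^ 4 ≤ 1 := by
    nlinarith [Real.cos_sq_le_one u, sq_nonneg (Real.cos u)]
  rcases hc.eq_or_lt with h | h
  · rw [h]; norm_num
  · have : 0 < 1 - Real.cos u ^ 4 := sub_pos.2 h
    positivity

theorem Wpot_pos {m3 : ℝ} (hm3 : 0 < m3) (u : ℝ) : 0 < Wpot m3 u := by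
  unfold Wpot
  positivity

theorem differentiableAt_Wpot {m3 : ℝ} (hm3 : 0 < m3) (u : ℝ) :
    DifferentiableAt ℝ (Wpot m3) u := by
  have hrad := Wpot_radicand_pos hm3 u
  unfold Wpot
  refine DifferentiableAt.add (by fun_prop) (DifferentiableAt.div (by fun_prop) ?_ ?_)
  · exact DifferentiableAt.sqrt (by fun_prop) hrad.ne'
  · exact (Real.sqrt_pos.2 hrad).ne'

theorem deriv_Wpot_div_cos_sq {m3 : ℝ} (hm3 : 0 < m3) {u : ℝ} (hu : Real.cos u ≠ 0) :
    deriv (fun x => Wpot m3 x / Real.cos x ^ 2) u =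
      (deriv (Wpot m3) u + 2 * Wpot m3 u / Real.cos u ^ 2 * (Real.sin u * Real.cos u)) /
        Real.cos u ^ 2 := by
  have h := (differentiableAt_Wpot hm3 u).hasDerivAt.div
    ((Real.hasDerivAt_cos u).pow 2) (pow_ne_zero 2 hu)
  refine h.deriv.trans ?_
  simp only [Pi.pow_apply]
  field_simp
  ring

/-- a point `p = (0, v0, u0, w0)` on the triple collision manifold `{s = 0}`
with `E(p) = 0` is an equilibrium of the regularized blown-up system (all four components
of the right-hand side vector field vanish at `p`) if and only if `w0 = 0`,
`cos u0 ≠ 0`, `v0² = 2W(u0)/cos²(u0)`, and `u0` is a critical point of the unregularized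
shape potential `u ↦ W(u)/cos²(u)`. -/
theorem stmt5 (m3 h : ℝ) (hm3 : 0 < m3) (v0 u0 w0 : ℝ)
    (hE : energyFn m3 h 0 v0 u0 w0 = 0) :
    (v0 * 0 * (1 - 0) * Real.cos u0 ^ 2 = 0 ∧
     1 / 2 * (1 - 0) * v0 ^ 2 * Real.cos u0 ^ 2 + w0 ^ 2 - (1 - 0) * Wpot m3 u0 = 0 ∧
     1 / 2 * Real.sqrt (1 + Real.cos u0 ^ 2) * w0 = 0 ∧
     -(1 / 2) * (1 + 0) * v0 * w0 * Real.cos u0 ^ 2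
       + 1 / 2 * Real.sqrt (1 + Real.cos u0 ^ 2) * (1 - 0) * deriv (Wpot m3) u0
       + 1 / 2 * (v0 ^ 2 - 2 * h * 0) * Real.sqrt (1 + Real.cos u0 ^ 2)
           * Real.sin u0 * Real.cos u0 = 0)
    ↔ (w0 = 0 ∧ Real.cos u0 ≠ 0 ∧ v0 ^ 2 = 2 * Wpot m3 u0 / Real.cos u0 ^ 2 ∧
       deriv (fun x => Wpot m3 x / Real.cos x ^ 2) u0 = 0) := by
  have hW := Wpot_pos hm3 u0
  have hr : 0 < Real.sqrt (1 + Real.cos u0 ^ 2) := by positivity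
  have hE' : 1 / 2 * (v0 ^ 2 * Real.cos u0 ^ 2 + w0 ^ 2) = Wpot m3 u0 := by
    unfold energyFn at hE
    linarith
  constructor
  · rintro ⟨-, -, hu, hw⟩
    have hw0 : w0 = 0 := by simpa [hr.ne'] using hu
    subst hw0
    have hc : Real.cos u0 ≠ 0 := by
      intro hc
      rw [hc] at hE'
      linarith
    have hv : v0 ^ 2 = 2 * Wpot m3 u0 / Real.cos u0 ^ 2 := by
      rw [eq_div_iff (pow_ne_zero 2 hc)]
      linarith
    refine ⟨rfl, hc, hv, ?_⟩
    rw [deriv_Wpot_div_cos_sq hm3 hc, ← hv]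
    have : Real.sqrt (1 + Real.cos u0 ^ 2) *
        (deriv (Wpot m3) u0 + v0 ^ 2 * (Real.sin u0 * Real.cos u0)) = 0 := by
      linear_combination 2 * hw
    rw [(mul_eq_zero.1 this).resolve_left hr.ne', zero_div]
  · rintro ⟨rfl, hc, hv, hd⟩
    rw [deriv_Wpot_div_cos_sq hm3 hc, ← hv, div_eq_zero_iff] at hd
    have hd' := hd.resolve_right (pow_ne_zero 2 hc)
    refine ⟨by ring, by linarith, by ring, ?_⟩
    linear_combination 1 / 2 * Real.sqrt (1 + Real.cos u0 ^ 2) * hd'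
end

section
/- Let h > 0 and let (s,v,u,w) be a solution of the regularized blown-up system satisfying the energy relation with 0 < s(tau) < 1 for all tau, and suppose v(tau*) >= 0 for some tau* (no forward triple collision). Then the shape variable u(tau) converges to a finite limit u_plus in R as tau -> +infinity. -/
open Real Filter Topology MeasureTheory

/-- A function that is antitone and bounded below near `+∞` converges. -/
theorem exists_tendsto_of_antitoneOn_Ici {f : ℝ → ℝ} {T m : ℝ} (hf : AntitoneOn f (Set.Ici T))
    (hm : ∀ t, T ≤ t → m ≤ f t) : ∃ l : ℝ, Tendsto f atTop (nhds l) := by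
  have hanti : Antitone fun t => f (max T t) := fun a b hab =>
    hf (Set.mem_Ici.2 (le_max_left _ _)) (Set.mem_Ici.2 (le_max_left _ _)) (max_le_max le_rfl hab)
  have hbdd : BddBelow (Set.range fun t => f (max T t)) :=
    ⟨m, by rintro _ ⟨t, rfl⟩; exact hm _ (le_max_left _ _)⟩
  refine ⟨_, (tendsto_atTop_ciInf hanti hbdd).congr' ?_⟩
  filter_upwards [eventually_ge_atTop T] with t ht
  rw [max_eq_right ht]

theorem antitoneOn_Ici_of_hasDerivAt {f f' : ℝ → ℝ} {T : ℝ}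
    (hf : ∀ t, T ≤ t → HasDerivAt f (f' t) t) (hf' : ∀ t, T ≤ t → f' t ≤ 0) :
    AntitoneOn f (Set.Ici T) := by
  refine antitoneOn_of_deriv_nonpos (convex_Ici T)
    (fun t ht => (hf t ht).continuousAt.continuousWithinAt) ?_ ?_
  · intro t ht
    rw [interior_Ici] at ht
    exact (hf t (le_of_lt ht)).differentiableAt.differentiableWithinAt
  · intro t ht
    rw [interior_Ici] at ht
    rw [(hf t (le_of_lt ht)).deriv]
    exact hf' t (le_of_lt ht)

theorem hasDerivAt_half_add_sin_two_mul (x : ℝ) :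
    HasDerivAt (fun x : ℝ => x / 2 + Real.sin (2 * x) / 4) (Real.cos x ^ 2) x := by
  have h := ((hasDerivAt_id x).div_const 2).add
    ((((hasDerivAt_id x).const_mul 2).sin).div_const 4)
  refine h.congr_deriv ?_
  simp only [id, Real.cos_two_mul]
  ring

theorem strictMono_half_add_sin_two_mul :
    StrictMono fun x : ℝ => x / 2 + Real.sin (2 * x) / 4 := by
  intro a b hab
  have hd : 0 < b - a := sub_pos.2 hab
  have h := Real.sin_sub_sin (2 * b) (2 * a)
  rw [show (2 * b - 2 * a) / 2 = b - a by ring] at h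
  have habs : |Real.sin (b - a) * Real.cos ((2 * b + 2 * a) / 2)| < b - a := by
    rw [abs_mul]
    refine lt_of_le_of_lt (mul_le_of_le_one_right (abs_nonneg _) (Real.abs_cos_le_one _)) ?_
    exact (Real.abs_sin_lt_abs hd.ne').trans_eq (abs_of_pos hd)
  have := (abs_lt.1 habs).1
  show a / 2 + Real.sin (2 * a) / 4 < b / 2 + Real.sin (2 * b) / 4
  linarith

/-- If `f / 2 + sin (2 f) / 4`, a primitive of `cos ^ 2` evaluated at `f`, converges,
then so does `f`. -/
theorem exists_tendsto_of_tendsto_half_add_sin_two_mul {α : Type*} {l : Filter α} {f : α → ℝ}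
    {L : ℝ} (h : Tendsto (fun t => f t / 2 + Real.sin (2 * f t) / 4) l (nhds L)) :
    ∃ a : ℝ, Tendsto f l (nhds a) := by
  have hcont : Continuous fun x : ℝ => x / 2 + Real.sin (2 * x) / 4 := by fun_prop
  obtain ⟨a, -, ha⟩ := intermediate_value_Icc (show 2 * L - 1 ≤ 2 * L + 1 by linarith)
    hcont.continuousOn (show L ∈ _ from
      ⟨by have := Real.sin_le_one (2 * (2 * L - 1)); linarith,
       by have := Real.neg_one_le_sin (2 * (2 * L + 1)); linarith⟩)
  refine ⟨a, tendsto_order.2 ⟨fun b hb => ?_, fun b hb => ?_⟩⟩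
  · have hlt := strictMono_half_add_sin_two_mul hb
    rw [ha] at hlt
    filter_upwards [h.eventually_const_lt hlt] with t ht
    exact strictMono_half_add_sin_two_mul.lt_iff_lt.1 ht
  · have hlt := strictMono_half_add_sin_two_mul hb
    rw [ha] at hlt
    filter_upwards [h.eventually_lt_const hlt] with t ht
    exact strictMono_half_add_sin_two_mul.lt_iff_lt.1 ht

theorem le_Wpot {m3 : ℝ} (hm3 : 0 < m3) (u : ℝ) : 1 / Real.sqrt 2 ≤ Wpot m3 u := by
  unfold Wpot
  have : 0 ≤ 2 * m3 * Real.cos u ^ 2 /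
      Real.sqrt (Real.cos u ^ 4 / 2 + (1 - Real.cos u ^ 4) / (2 * m3 / (2 + m3))) := by
    positivity
  linarith

theorem Wpot_le {m3 : ℝ} (hm3 : 0 < m3) (u : ℝ) :
    Wpot m3 u ≤ 1 / Real.sqrt 2 + 2 * m3 / Real.sqrt (1 / 2) := by
  unfold Wpot
  have hc : Real.cos u ^ 2 ≤ 1 := Real.cos_sq_le_one u
  have hc4 : Real.cos u ^ 4 ≤ 1 := by nlinarith [sq_nonneg (Real.cos u)]
  have hmu : (1 - Real.cos u ^ 4) / 2 ≤ (1 - Real.cos u ^ 4) / (2 * m3 / (2 + m3)) := by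
    have h2 : 2 * m3 / (2 + m3) ≤ 2 := by
      rw [div_le_iff₀ (by positivity)]
      linarith
    exact div_le_div_of_nonneg_left (by linarith) (by positivity) h2
  have hnum : 2 * m3 * Real.cos u ^ 2 ≤ 2 * m3 := mul_le_of_le_one_right (by positivity) hc
  have hden : 1 / 2 ≤ Real.cos u ^ 4 / 2 + (1 - Real.cos u ^ 4) / (2 * m3 / (2 + m3)) := by
    linarith
  exact add_le_add le_rfl (div_le_div₀ (by positivity) hnum (by positivity)
    (Real.sqrt_le_sqrt hden))

section Solution

variable {m3 h : ℝ} {s v u w : ℝ → ℝ}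

theorem IsSolution.hasDerivAt_v (hsol : IsSolution m3 h s v u w)
    (hE : SatisfiesEnergy m3 h s v u w) (τ : ℝ) :
    HasDerivAt v (w τ ^ 2 / 2 + s τ * Real.cos (u τ) ^ 2 * (h - v τ ^ 2 / 2)) τ := by
  refine (hsol.2.1 τ).congr_deriv ?_
  have := hE τ
  unfold energyFn at this
  linarith

/-- On the energy level, `v` is strictly increasing where `v ^ 2 < 2 * h`. -/
theorem SatisfiesEnergy.deriv_v_pos (hm3 : 0 < m3) (hE : SatisfiesEnergy m3 h s v u w)
    (hs : ∀ τ : ℝ, 0 < s τ ∧ s τ < 1) {τ : ℝ} (hv : v τ ^ 2 < 2 * h) :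
    0 < w τ ^ 2 / 2 + s τ * Real.cos (u τ) ^ 2 * (h - v τ ^ 2 / 2) := by
  have hpos : 0 < h - v τ ^ 2 / 2 := by linarith
  have hs0 := (hs τ).1
  by_cases hc : Real.cos (u τ) = 0
  · have hEτ := hE τ
    have hW := mul_pos (sub_pos.2 (hs τ).2) (Wpot_pos hm3 (u τ))
    simp only [energyFn, hc] at hEτ
    rw [hc]
    nlinarith
  · positivity

/-- Lower barriers below `√(2 h)` for `v` are never crossed. -/
theorem IsSolution.le_v (hm3 : 0 < m3) (hsol : IsSolution m3 h s v u w)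
    (hE : SatisfiesEnergy m3 h s v u w) (hs : ∀ τ : ℝ, 0 < s τ ∧ s τ < 1) {a b : ℝ}
    (hb : b ^ 2 < 2 * h) (hab : b ≤ v a) {τ : ℝ} (hτ : a ≤ τ) : b ≤ v τ := by
  have hd := hsol.hasDerivAt_v hE
  have := image_le_of_deriv_right_lt_deriv_boundary' (f := fun t => -v t)
    (B := fun _ => -b) (B' := fun _ => 0) (a := a) (b := τ)
    (fun t _ => (hd t).neg.continuousAt.continuousWithinAt)
    (fun t _ => (hd t).neg.hasDerivWithinAt) (by simpa using hab) continuousOn_const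
    (fun t _ => hasDerivWithinAt_const _ _ _)
    (fun t _ ht => by
      have hvt : v t = b := neg_injective ht
      have := hE.deriv_v_pos hm3 hs (τ := t) (by rw [hvt]; exact hb)
      linarith) (Set.right_mem_Icc.2 hτ)
  exact neg_le_neg_iff.1 this

theorem IsSolution.exists_v_pos (hm3 : 0 < m3) (hh : 0 < h) (hsol : IsSolution m3 h s v u w)
    (hE : SatisfiesEnergy m3 h s v u w) (hs : ∀ τ : ℝ, 0 < s τ ∧ s τ < 1) {a : ℝ}
    (ha : 0 ≤ v a) : ∃ b, 0 < v b := by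
  by_contra! hneg
  have hzero : ∀ t, a ≤ t → v t = 0 := fun t ht =>
    le_antisymm (hneg t) (hsol.le_v hm3 hE hs (by simpa using hh) ha ht)
  have hmax : IsLocalMax v a := by
    refine Eventually.of_forall fun t => ?_
    rw [hzero a le_rfl]
    exact hneg t
  have h0 := hmax.hasDerivAt_eq_zero (hsol.hasDerivAt_v hE a)
  have := hE.deriv_v_pos hm3 hs (τ := a) (by rw [hzero a le_rfl]; simpa using hh)
  linarith

/-- Sundman's function `r ^ 2 * (h - v ^ 2 / (2 * s))` with `r = s / (1 - s)`. -/
theorem IsSolution.hasDerivAt_sundman (hsol : IsSolution m3 h s v u w)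
    (hE : SatisfiesEnergy m3 h s v u w) (hs : ∀ τ : ℝ, 0 < s τ ∧ s τ < 1) (τ : ℝ) :
    HasDerivAt (fun τ => s τ * (h * s τ - v τ ^ 2 / 2) / (1 - s τ) ^ 2)
      (-(v τ * s τ * Wpot m3 (u τ) / (1 - s τ))) τ := by
  have hsd := hsol.1 τ
  have hvd := hsol.2.1 τ
  have hσ : 1 - s τ ≠ 0 := (sub_pos.2 (hs τ).2).ne'
  have hnum := hsd.mul ((hsd.const_mul h).sub ((hvd.pow 2).div_const 2))
  have hden := (hsd.const_sub 1).pow 2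
  refine (hnum.div hden (pow_ne_zero 2 hσ)).congr_deriv ?_
  have hW : w τ ^ 2 = 2 * ((1 - s τ) * Wpot m3 (u τ) + h * s τ * Real.cos (u τ) ^ 2)
      - v τ ^ 2 * Real.cos (u τ) ^ 2 := by
    have := hE τ
    unfold energyFn at this
    linarith
  simp only [Pi.pow_apply, Pi.mul_apply, Pi.sub_apply, hW]
  field_simp
  ring

/-- Once `v` is bounded below by a positive constant, Sundman's function becomes negative. -/
theorem IsSolution.exists_lt_v_sq (hm3 : 0 < m3) (hsol : IsSolution m3 h s v u w)
    (hE : SatisfiesEnergy m3 h s v u w) (hs : ∀ τ : ℝ, 0 < s τ ∧ s τ < 1) {a b s₀ : ℝ}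
    (hb : 0 < b) (hv : ∀ t, a ≤ t → b ≤ v t) (hs₀ : 0 < s₀) (hss : ∀ t, a ≤ t → s₀ ≤ s t) :
    ∃ T, a ≤ T ∧ ∀ t, T ≤ t → 2 * h * s t < v t ^ 2 := by
  set G : ℝ → ℝ := fun τ => s τ * (h * s τ - v τ ^ 2 / 2) / (1 - s τ) ^ 2
  set k : ℝ := b * s₀ * (1 / Real.sqrt 2)
  have hkpos : 0 < k := by positivity
  have hanti : AntitoneOn (fun t => G t + k * t) (Set.Ici a) := by
    refine antitoneOn_Ici_of_hasDerivAt
      (fun t _ => (hsol.hasDerivAt_sundman hE hs t).add ((hasDerivAt_id t).const_mul k)) ?_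
    intro t ht
    have hσ := sub_pos.2 (hs t).2
    have h1 : k ≤ v t * s t * Wpot m3 (u t) :=
      mul_le_mul (mul_le_mul (hv t ht) (hss t ht) hs₀.le (hb.le.trans (hv t ht)))
        (le_Wpot hm3 _) (by positivity)
        (mul_nonneg (hb.le.trans (hv t ht)) (hs t).1.le)
    have h2 : v t * s t * Wpot m3 (u t) ≤ v t * s t * Wpot m3 (u t) / (1 - s t) :=
      le_div_self (hkpos.le.trans h1) hσ (by linarith [(hs t).1])
    linarith
  refine ⟨max a ((G a + k * a) / k + 1), le_max_left _ _, fun t ht => ?_⟩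
  have hat := (le_max_left _ _).trans ht
  have hbig : G a + k * a < k * t := by
    have : (G a + k * a) / k < t := by linarith [(le_max_right _ _).trans ht]
    rwa [div_lt_iff₀' hkpos] at this
  have hGt : G t < 0 := by
    have := hanti (Set.mem_Ici.2 le_rfl) (Set.mem_Ici.2 hat) hat
    simp only at this
    linarith
  by_contra! hle
  have : 0 ≤ G t :=
    div_nonneg (mul_nonneg (hs t).1.le (by linarith)) (sq_nonneg _)
  linarith

theorem IsSolution.hasDerivAt_sqrt_one_sub (hsol : IsSolution m3 h s v u w)
    (hs : ∀ τ : ℝ, 0 < s τ ∧ s τ < 1) (τ : ℝ) :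
    HasDerivAt (fun τ => Real.sqrt (1 - s τ))
      (-(v τ * s τ * Real.sqrt (1 - s τ) * Real.cos (u τ) ^ 2 / 2)) τ := by
  have hσ := sub_pos.2 (hs τ).2
  refine (((hsol.1 τ).const_sub 1).sqrt hσ.ne').congr_deriv ?_
  have hr := Real.sqrt_pos.2 hσ
  have hsq := Real.sq_sqrt hσ.le
  rw [div_eq_iff (by positivity)]
  linear_combination (-(v τ * s τ * Real.cos (u τ) ^ 2)) * (-hsq)

/-- Where Sundman's function is negative, the shape velocity is `O(√(1 - s))`. -/
theorem SatisfiesEnergy.abs_w_le (hm3 : 0 < m3) (hE : SatisfiesEnergy m3 h s v u w)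
    (hs : ∀ τ : ℝ, 0 < s τ ∧ s τ < 1) {τ : ℝ} (hv : 2 * h * s τ < v τ ^ 2) :
    |w τ| ≤ Real.sqrt (2 * (1 / Real.sqrt 2 + 2 * m3 / Real.sqrt (1 / 2))) *
      Real.sqrt (1 - s τ) := by
  rw [← Real.sqrt_mul (by positivity)]
  refine Real.abs_le_sqrt ?_
  have hσ := sub_pos.2 (hs τ).2
  have h1 := mul_le_mul_of_nonneg_left (Wpot_le hm3 (u τ)) hσ.le
  have h2 := mul_nonneg (sub_pos.2 hv).le (sq_nonneg (Real.cos (u τ)))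
  have h3 := hE τ
  unfold energyFn at h3
  linarith

end Solution

/-- for a solution with `h > 0`, `0 < s < 1` and no forward triple collision
(`v(τ*) ≥ 0` for some `τ*`), the shape variable `u(τ)` converges to a finite limit as
`τ → +∞`. -/
theorem stmt12 (m3 h : ℝ) (hm3 : 0 < m3) (hh : 0 < h) (s v u w : ℝ → ℝ)
    (hsol : IsSolution m3 h s v u w) (hE : SatisfiesEnergy m3 h s v u w)
    (hs : ∀ τ : ℝ, 0 < s τ ∧ s τ < 1) (hv : ∃ τs : ℝ, 0 ≤ v τs) :
    ∃ uplus : ℝ, Tendsto u atTop (nhds uplus) := by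
  obtain ⟨τs, hτs⟩ := hv
  obtain ⟨a, ha⟩ := hsol.exists_v_pos hm3 hh hE hs hτs
  obtain ⟨b, hb, hvb⟩ : ∃ b, 0 < b ∧ ∀ t, a ≤ t → b ≤ v t := by
    refine ⟨min (v a) (Real.sqrt h), lt_min ha (Real.sqrt_pos.2 hh), fun t ht =>
      hsol.le_v hm3 hE hs ?_ (min_le_left _ _) ht⟩
    have h1 : 0 < min (v a) (Real.sqrt h) := lt_min ha (Real.sqrt_pos.2 hh)
    have h2 := pow_le_pow_left₀ h1.le (min_le_right (v a) (Real.sqrt h)) 2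
    rw [Real.sq_sqrt hh.le] at h2
    linarith
  have hsa : ∀ t, a ≤ t → s a ≤ s t := by
    intro t ht
    have hanti : AntitoneOn (fun t => -s t) (Set.Ici a) := by
      refine antitoneOn_Ici_of_hasDerivAt (fun t _ => (hsol.1 t).neg) fun t ht => ?_
      have := hb.trans_le (hvb t ht)
      have := (hs t).1
      have := sub_pos.2 (hs t).2
      rw [neg_nonpos]
      positivity
    exact neg_le_neg_iff.1 (hanti (Set.mem_Ici.2 le_rfl) (Set.mem_Ici.2 ht) ht)
  obtain ⟨T, haT, hT⟩ := hsol.exists_lt_v_sq hm3 hE hs hb hvb (hs a).1 hsa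
  set M : ℝ := Real.sqrt (2 * (1 / Real.sqrt 2 + 2 * m3 / Real.sqrt (1 / 2)))
  have hs0 := (hs a).1
  set K : ℝ := 2 * M / (b * s a) with hK
  have hKnonneg : 0 ≤ K := by positivity
  set R : ℝ → ℝ := fun t => v t * s t * Real.sqrt (1 - s t) * Real.cos (u t) ^ 2 / 2 with hR
  have hρ : ∀ t, HasDerivAt (fun t => Real.sqrt (1 - s t)) (-R t) t :=
    hsol.hasDerivAt_sqrt_one_sub hs
  have hΦ : ∀ t, HasDerivAt (fun t => u t / 2 + Real.sin (2 * u t) / 4)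
      (Real.cos (u t) ^ 2 * (1 / 2 * Real.sqrt (1 + Real.cos (u t) ^ 2) * w t)) t :=
    fun t => (hasDerivAt_half_add_sin_two_mul (u t)).comp t (hsol.2.2.1 t)
  have hbound : ∀ t, T ≤ t →
      |Real.cos (u t) ^ 2 * (1 / 2 * Real.sqrt (1 + Real.cos (u t) ^ 2) * w t)| ≤ K * R t := by
    intro t ht
    have hw : |w t| ≤ M * Real.sqrt (1 - s t) := hE.abs_w_le hm3 hs (hT t ht)
    have hroot : Real.sqrt (1 + Real.cos (u t) ^ 2) ≤ 2 :=
      Real.sqrt_le_iff.2 ⟨by norm_num, by linarith [Real.cos_sq_le_one (u t)]⟩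
    have hbs : b * s a ≤ v t * s t :=
      mul_le_mul (hvb t (haT.trans ht)) (hsa t (haT.trans ht)) hs0.le
        (hb.le.trans (hvb t (haT.trans ht)))
    have hKbs : M ≤ K * (v t * s t) / 2 := by
      have h1 := mul_le_mul_of_nonneg_left hbs hKnonneg
      rw [hK, div_mul_cancel₀ _ (by positivity)] at h1
      linarith
    calc |Real.cos (u t) ^ 2 * (1 / 2 * Real.sqrt (1 + Real.cos (u t) ^ 2) * w t)|
        = Real.cos (u t) ^ 2 * (1 / 2 * Real.sqrt (1 + Real.cos (u t) ^ 2) * |w t|) := by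
          rw [abs_mul, abs_mul, abs_of_nonneg (sq_nonneg (Real.cos (u t))),
            abs_of_nonneg (by positivity : 0 ≤ 1 / 2 * Real.sqrt (1 + Real.cos (u t) ^ 2))]
      _ ≤ Real.cos (u t) ^ 2 * (1 / 2 * 2 * (M * Real.sqrt (1 - s t))) := by gcongr
      _ ≤ Real.cos (u t) ^ 2 * (1 / 2 * 2 * (K * (v t * s t) / 2 * Real.sqrt (1 - s t))) := by
          gcongr
      _ = K * R t := by simp only [hR]; ring
  obtain ⟨lρ, hlρ⟩ : ∃ l, Tendsto (fun t => Real.sqrt (1 - s t)) atTop (nhds l) := by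
    refine exists_tendsto_of_antitoneOn_Ici (T := a) (m := 0)
      (antitoneOn_Ici_of_hasDerivAt (fun t _ => hρ t) fun t ht => ?_)
      fun t _ => Real.sqrt_nonneg _
    have := hb.trans_le (hvb t ht)
    have := (hs t).1
    rw [neg_nonpos]
    positivity
  have hsum : AntitoneOn (fun t => u t / 2 + Real.sin (2 * u t) / 4 + K * Real.sqrt (1 - s t))
      (Set.Ici T) := by
    refine antitoneOn_Ici_of_hasDerivAt (fun t _ => (hΦ t).add ((hρ t).const_mul K))
      fun t ht => ?_
    linarith [(abs_le.1 (hbound t ht)).2]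
  have hdiff : AntitoneOn (fun t => -(u t / 2 + Real.sin (2 * u t) / 4) + K * Real.sqrt (1 - s t))
      (Set.Ici T) := by
    refine antitoneOn_Ici_of_hasDerivAt (fun t _ => (hΦ t).neg.add ((hρ t).const_mul K))
      fun t ht => ?_
    linarith [(abs_le.1 (hbound t ht)).1]
  obtain ⟨l, hl⟩ := exists_tendsto_of_antitoneOn_Ici hsum
    (m := u T / 2 + Real.sin (2 * u T) / 4 - K * Real.sqrt (1 - s T)) fun t ht => by
      have h1 := hdiff (Set.mem_Ici.2 le_rfl) (Set.mem_Ici.2 ht) ht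
      have h2 := mul_nonneg hKnonneg (Real.sqrt_nonneg (1 - s t))
      simp only at h1
      linarith
  refine exists_tendsto_of_tendsto_half_add_sin_two_mul (L := l - K * lρ) ?_
  exact (hl.sub (hlρ.const_mul K)).congr fun t => by ring
end
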